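/- For every L_⊗-sentence φ, the set FSpec(φ) = {n ∈ ℕ : MSO(n) ⊨ φ} is ultimately periodic. -/

import Mathlib

open FirstOrder FirstOrder.Language

namespace MSO

/-! ### The language `L_⊗` and its semantics -/

/-- The language `L_⊗`: a constant `⊥`, a unary relation `At`,
and two binary relations: `⊆` (encoded `true`) and `≤ᴱ` (encoded `false`). -/
def Lmso : Language where
  Functions := fun n => match n with | 0 => Unit | _ => Empty
  Relations := fun n => match n with | 1 => Unit | 2 => Bool | _ => Empty

/-- The constant symbol `⊥`. -/
def botC : Lmso.Constants := Unit.unit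
/-- The unary relation symbol `At`. -/
def atR : Lmso.Relations 1 := Unit.unit
/-- The binary relation symbol `⊆`. -/
def subR : Lmso.Relations 2 := true
/-- The binary relation symbol `≤ᴱ`. -/
def exleR : Lmso.Relations 2 := false

/-- The interpretation of `⊥` in an `L_⊗`-structure. -/
def botE (M : Type*) [Lmso.Structure M] : M := Structure.funMap botC ![]
/-- The interpretation of `At` in an `L_⊗`-structure. -/
def atE {M : Type*} [Lmso.Structure M] (a : M) : Prop := Structure.RelMap atR ![a]
/-- The interpretation of `⊆` in an `L_⊗`-structure. -/
def subE {M : Type*} [Lmso.Structure M] (a b : M) : Prop := Structure.RelMap subR ![a, b]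
/-- The interpretation of `≤ᴱ` in an `L_⊗`-structure. -/
def exleE {M : Type*} [Lmso.Structure M] (a b : M) : Prop := Structure.RelMap exleR ![a, b]

/-- The monadic second order version `M̃SO(α)` of a linear order `α`, as an `L_⊗`-structure:
the universe is the powerset of `α`, `⊆` is inclusion, `⊥` is `∅`, `At` holds of singletons,
and `A ≤ᴱ B` iff there are `a ∈ A` and `b ∈ B` with `a < b`. -/
instance msoStructure (α : Type*) [LinearOrder α] : Lmso.Structure (Set α) where
  funMap := fun {n} f _ => match n, f with
    | 0, _ => (∅ : Set α)
  RelMap := fun {n} r v => match n, r with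
    | 1, _ => ∃ a : α, v 0 = {a}
    | 2, true => v 0 ⊆ v 1
    | 2, false => ∃ a ∈ v 0, ∃ b ∈ v 1, a < b

/-- `MSO(n)`, the monadic second order version of the `n`-element linear order. -/
abbrev MSOn (n : ℕ) : Type := Set (Fin n)

/-- The operation `⊗` on `L_⊗`-structures: the universe is the product, `⊆` is componentwise,
`⊥` is the pair of bottoms, `At` holds of the atoms (minimal non-bottom elements) of the
resulting order, and `(A,B) ≤ᴱ (C,D)` iff (`A ≠ ⊥` and `D ≠ ⊥`), or `A ≤ᴱ C`, or `B ≤ᴱ D`. -/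
instance tensorStructure (M N : Type*) [Lmso.Structure M] [Lmso.Structure N] :
    Lmso.Structure (M × N) where
  funMap := fun {n} f _ => match n, f with
    | 0, _ => (botE M, botE N)
  RelMap := fun {n} r v => match n, r with
    | 1, _ => v 0 ≠ (botE M, botE N) ∧
        ∀ q : M × N, subE q.1 (v 0).1 → subE q.2 (v 0).2 →
          q = (botE M, botE N) ∨ q = v 0
    | 2, true => subE (v 0).1 (v 1).1 ∧ subE (v 0).2 (v 1).2
    | 2, false => ((v 0).1 ≠ botE M ∧ (v 1).2 ≠ botE N) ∨
        exleE (v 0).1 (v 1).1 ∨ exleE (v 0).2 (v 1).2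

/-! ### Formulas -/

/-- Bounded `L_⊗`-formulas with no free (outer) variables. -/
abbrev BF (n : ℕ) := Lmso.BoundedFormula Empty n

/-- The `i`-th de Bruijn variable as a term. -/
def tv {n : ℕ} (i : Fin n) : Lmso.Term (Empty ⊕ Fin n) := Term.var (Sum.inr i)
/-- The constant `⊥` as a term. -/
def tb {n : ℕ} : Lmso.Term (Empty ⊕ Fin n) := Constants.term botC

def sub' {n : ℕ} (i j : Fin n) : BF n := subR.boundedFormula₂ (tv i) (tv j)
def exle' {n : ℕ} (i j : Fin n) : BF n := exleR.boundedFormula₂ (tv i) (tv j)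
def at' {n : ℕ} (i : Fin n) : BF n := atR.boundedFormula₁ (tv i)
def eq' {n : ℕ} (i j : Fin n) : BF n := Term.bdEqual (tv i) (tv j)
def isBot' {n : ℕ} (i : Fin n) : BF n := Term.bdEqual (tv i) tb
def botSub' {n : ℕ} (i : Fin n) : BF n := subR.boundedFormula₂ tb (tv i)

/-- Finite conjunction. -/
def bigAnd {n : ℕ} (l : List (BF n)) : BF n := l.foldr (· ⊓ ·) ⊤
/-- Finite disjunction. -/
def bigOr {n : ℕ} (l : List (BF n)) : BF n := l.foldr (· ⊔ ·) ⊥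

/-- `k` is the meet of `i` and `j` (with respect to `⊆`). -/
def isMeet {n : ℕ} (k i j : Fin n) : BF n :=
  sub' k i ⊓ sub' k j ⊓
    ∀' ((sub' (Fin.last n) i.castSucc ⊓ sub' (Fin.last n) j.castSucc) ⟹
      sub' (Fin.last n) k.castSucc)

/-- `k` is the join of `i` and `j` (with respect to `⊆`). -/
def isJoin {n : ℕ} (k i j : Fin n) : BF n :=
  sub' i k ⊓ sub' j k ⊓
    ∀' ((sub' i.castSucc (Fin.last n) ⊓ sub' j.castSucc (Fin.last n)) ⟹
      sub' k.castSucc (Fin.last n))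

/-- The meet of `i` and `j` is `⊥`. -/
def meetIsBot {n : ℕ} (i j : Fin n) : BF n :=
  ∀' ((sub' (Fin.last n) i.castSucc ⊓ sub' (Fin.last n) j.castSucc) ⟹ isBot' (Fin.last n))

/-- The join of `i` and `j` is the top element. -/
def joinIsTop {n : ℕ} (i j : Fin n) : BF n :=
  ∀' ((sub' i.castSucc (Fin.last n) ⊓ sub' j.castSucc (Fin.last n)) ⟹
    ∀' (sub' (Fin.last (n + 1)) ((Fin.last n).castSucc)))

/-- `j` is a (Boolean) complement of `i`. -/
def isComplOf {n : ℕ} (j i : Fin n) : BF n := meetIsBot i j ⊓ joinIsTop i j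

/-- `i` is an atom: non-bottom, and minimal among non-bottom elements. -/
def isAtomDef {n : ℕ} (i : Fin n) : BF n :=
  ∼(isBot' i) ⊓
    ∀' (sub' (Fin.last n) i.castSucc ⟹ (isBot' (Fin.last n) ⊔ eq' (Fin.last n) i.castSucc))

/-! ### The base theory `T_base` -/

def axRefl : Lmso.Sentence := ∀' sub' 0 0
def axAntisymm : Lmso.Sentence := ∀' ∀' ((sub' 0 1 ⊓ sub' 1 0) ⟹ eq' 0 1)
def axTrans : Lmso.Sentence := ∀' ∀' ∀' ((sub' 0 1 ⊓ sub' 1 2) ⟹ sub' 0 2)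
def axBotLe : Lmso.Sentence := ∀' botSub' 0
def axTop : Lmso.Sentence := ∃' ∀' (sub' 1 0)
def axMeet : Lmso.Sentence := ∀' ∀' ∃' (isMeet 2 0 1)
def axJoin : Lmso.Sentence := ∀' ∀' ∃' (isJoin 2 0 1)
def axCompl : Lmso.Sentence := ∀' ∃' (isComplOf 1 0)
def axDistrib : Lmso.Sentence :=
  ∀' ∀' ∀' ∀' ∀' ∀' ∀' ∀'
    ((isMeet 3 0 1 ⊓ isMeet 4 0 2 ⊓ isJoin 5 1 2 ⊓ isMeet 6 0 5 ⊓ isJoin 7 3 4) ⟹ sub' 6 7)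
def axAt : Lmso.Sentence := ∀' (at' 0 ⇔ isAtomDef 0)
def axAtomic : Lmso.Sentence := ∀' (∼(isBot' 0) ⟹ ∃' (at' 1 ⊓ sub' 1 0))
def axIrrefl : Lmso.Sentence := ∀' (at' 0 ⟹ ∼(exle' 0 0))
def axTransAt : Lmso.Sentence :=
  ∀' ∀' ∀' ((at' 0 ⊓ at' 1 ⊓ at' 2 ⊓ exle' 0 1 ⊓ exle' 1 2) ⟹ exle' 0 2)
def axTrich : Lmso.Sentence :=
  ∀' ∀' ((at' 0 ⊓ at' 1) ⟹ (exle' 0 1 ⊔ eq' 0 1 ⊔ exle' 1 0))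
def axExleDef : Lmso.Sentence :=
  ∀' ∀' (exle' 0 1 ⇔ ∃' ∃' (at' 2 ⊓ at' 3 ⊓ sub' 2 0 ⊓ sub' 3 1 ⊓ exle' 2 3))

/-- The comprehension axiom for a formula `η(x; Y₁,…,Yₙ)` (with `x` the last variable):
`∀ Ȳ ∃ X ∀ x (At x → (x ⊆ X ↔ η(x; Ȳ)))`. -/
def compAx {n : ℕ} (η : BF (n + 1)) : Lmso.Sentence :=
  BoundedFormula.alls (∃' ∀' (at' (Fin.last (n + 1)) ⟹
    (sub' (Fin.last (n + 1)) ((Fin.last n).castSucc) ⇔ η.liftAt 1 n)))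

/-- The base theory `T_base`: an atomic Boolean algebra under `⊆` with bottom `⊥`, `At`
holding exactly of the atoms, `≤ᴱ` linearly ordering the atoms and determined by its
restriction to the atoms, together with the comprehension scheme. -/
def Tbase : Lmso.Theory :=
  {axRefl, axAntisymm, axTrans, axBotLe, axTop, axMeet, axJoin, axCompl, axDistrib,
    axAt, axAtomic, axIrrefl, axTransAt, axTrich, axExleDef} ∪
  ⋃ n : ℕ, Set.range (compAx (n := n))

/-! ### The theory `T_MSO(Fin)` -/

/-- `i` is the `≤ᴱ`-least atom. -/
def isLeastAtom {n : ℕ} (i : Fin n) : BF n :=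
  at' i ⊓ ∀' (at' (Fin.last n) ⟹ ∼(exle' (Fin.last n) i.castSucc))

/-- `i` is the `≤ᴱ`-greatest atom. -/
def isGreatestAtom {n : ℕ} (i : Fin n) : BF n :=
  at' i ⊓ ∀' (at' (Fin.last n) ⟹ ∼(exle' i.castSucc (Fin.last n)))

/-- `j` is the immediate `≤ᴱ`-successor of the atom `i`. -/
def isSuccOf {n : ℕ} (j i : Fin n) : BF n :=
  at' i ⊓ at' j ⊓ exle' i j ⊓
    ∀' ((at' (Fin.last n) ⊓ exle' i.castSucc (Fin.last n)) ⟹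
      (eq' (Fin.last n) j.castSucc ⊔ exle' j.castSucc (Fin.last n)))

def axLeastAtom : Lmso.Sentence := (∃' at' 0) ⟹ ∃' isLeastAtom 0
def axGreatestAtom : Lmso.Sentence := (∃' at' 0) ⟹ ∃' isGreatestAtom 0
def axSucc : Lmso.Sentence :=
  ∀' ((at' 0 ⊓ ∃' (at' 1 ⊓ exle' 0 1)) ⟹ ∃' isSuccOf 1 0)
def axPred : Lmso.Sentence :=
  ∀' ((at' 0 ⊓ ∃' (at' 1 ⊓ exle' 1 0)) ⟹ ∃' isSuccOf 0 1)
def axLeastIn : Lmso.Sentence :=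
  ∀' (∼(isBot' 0) ⟹ ∃' (at' 1 ⊓ sub' 1 0 ⊓ ∀' ((at' 2 ⊓ sub' 2 0) ⟹ ∼(exle' 2 1))))

/-- The theory `T_MSO(Fin)`: `T_base` together with axioms saying that the ordering of the
atoms is discrete with endpoints, and every non-bottom element contains a least atom. -/
def TMSOFin : Lmso.Theory :=
  Tbase ∪ {axLeastAtom, axGreatestAtom, axSucc, axPred, axLeastIn}

/-! ### Quantifier rank, unnested formulas, and `≈ₖ` -/

/-- Quantifier rank of a bounded formula. -/
def qr : ∀ {n : ℕ}, BF n → ℕ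
  | _, BoundedFormula.falsum => 0
  | _, BoundedFormula.equal _ _ => 0
  | _, BoundedFormula.rel _ _ => 0
  | _, BoundedFormula.imp f g => max (qr f) (qr g)
  | _, BoundedFormula.all f => qr f + 1

/-- A formula is unnested if every atomic subformula is of one of the forms
`x = y`, `c = y`, or `R x̄` with the `xᵢ`, `y` variables (Hodges). -/
def IsUnnested : ∀ {n : ℕ}, BF n → Prop
  | _, BoundedFormula.falsum => True
  | _, BoundedFormula.equal s t =>
      (∃ i j, s = Term.var i ∧ t = Term.var j) ∨
      (∃ (c : Lmso.Constants) (j : _), s = Constants.term c ∧ t = Term.var j)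
  | _, BoundedFormula.rel _ ts => ∀ i, ∃ j, ts i = Term.var j
  | _, BoundedFormula.imp f g => IsUnnested f ∧ IsUnnested g
  | _, BoundedFormula.all f => IsUnnested f

/-- `M ≈ₖ N` : `M` and `N` satisfy the same unnested `L_⊗`-sentences of quantifier
rank at most `k`. -/
def EquivK (k : ℕ) (M N : Type*) [Lmso.Structure M] [Lmso.Structure N] : Prop :=
  ∀ φ : Lmso.Sentence, IsUnnested φ → qr φ ≤ k → (M ⊨ φ ↔ N ⊨ φ)

/-! ### The sentences `ρ_{d,h}`, `ψ_{>n}`, `ψ_{=n}` -/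

/-- The index (in `Fin d`) of `A_h` among `A₁, …, A_d`, identifying `h = 0` with `h = d`. -/
def aIdx (d h : ℕ) (hd : 0 < d) : Fin d := ⟨(h + d - 1) % d, Nat.mod_lt _ hd⟩

/-- The cyclic successor on the indices `{1, …, d}`. -/
def cyc {d : ℕ} (j : Fin d) : Fin d := ⟨((j : ℕ) + 1) % d, Nat.mod_lt _ j.pos⟩

/-- The sentence `ρ_{d,h}`: there is a partition of the atoms into `d` non-bottom elements
`A₁, …, A_d` such that the least atom is in `A₁`, the immediate successor of an atom lying in
`A_j` lies in `A_{j+1}` (cyclically), and the greatest atom is in `A_h`. -/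
def rho (d h : ℕ) : Lmso.Sentence :=
  if hd : 0 < d then
    BoundedFormula.exs (n := d) (
      -- each `A_i` is non-bottom
      bigAnd ((List.finRange d).map fun i => ∼(isBot' i)) ⊓
      -- every atom lies in some `A_i`
      (∀' (at' (Fin.last d) ⟹
        bigOr ((List.finRange d).map fun i => sub' (Fin.last d) i.castSucc))) ⊓
      -- the `A_i` are pairwise disjoint on atoms
      bigAnd ((List.finRange d).flatMap fun i => (List.finRange d).filterMap fun j =>
        if i.val < j.val then
          some (∀' (at' (Fin.last d) ⟹
            ∼(sub' (Fin.last d) i.castSucc ⊓ sub' (Fin.last d) j.castSucc)))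
        else none) ⊓
      -- the least atom lies in `A₁`
      (∀' (isLeastAtom (Fin.last d) ⟹ sub' (Fin.last d) ((aIdx d 1 hd).castSucc))) ⊓
      -- immediate successors move cyclically through the `A_j`
      bigAnd ((List.finRange d).map fun j =>
        ∀' ∀' ((sub' ((Fin.last d).castSucc) (j.castSucc.castSucc) ⊓
            isSuccOf (Fin.last (d + 1)) ((Fin.last d).castSucc)) ⟹
          sub' (Fin.last (d + 1)) ((cyc j).castSucc.castSucc))) ⊓
      -- the greatest atom lies in `A_h`
      (∀' (isGreatestAtom (Fin.last d) ⟹ sub' (Fin.last d) ((aIdx d h hd).castSucc))))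
  else ⊥

/-- The list of formulas `xᵢ ≠ xⱼ` for `i < j < n`. -/
def distinctPairs (n : ℕ) : List (BF n) :=
  (List.finRange n).flatMap fun i => (List.finRange n).filterMap fun j =>
    if i.val < j.val then some (∼(eq' i j)) else none

/-- `ψ_{>n}` : there exist at least `n + 1` distinct atoms. -/
def psiGt (n : ℕ) : Lmso.Sentence :=
  BoundedFormula.exs (n := n + 1)
    (bigAnd ((List.finRange (n + 1)).map fun i => at' i) ⊓ bigAnd (distinctPairs (n + 1)))

/-- `ψ_{=n}` : there exist exactly `n` distinct atoms. -/
def psiEq (n : ℕ) : Lmso.Sentence :=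
  BoundedFormula.exs (n := n)
    (bigAnd ((List.finRange n).map fun i => at' i) ⊓ bigAnd (distinctPairs n) ⊓
      ∀' (at' (Fin.last n) ⟹ bigOr ((List.finRange n).map fun i => eq' (Fin.last n) i.castSucc)))

/-! ### Residue functions and the theories `T_r̃` -/

/-- A residue function `ℙ × ℕ_{>0} → ℕ` (conditions imposed only at primes `p` and `j ≥ 1`):
`r(p,j) < p^j` and `r(p,j+1) ≡ r(p,j) [MOD p^j]`. -/
def IsResidueFunction (r : ℕ → ℕ → ℕ) : Prop :=
  ∀ p j : ℕ, p.Prime → 1 ≤ j → r p j < p ^ j ∧ r p (j + 1) ≡ r p j [MOD p ^ j]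

/-- A function `ℕ_{>1} → ℕ` is a residue function if it arises from a residue function
`ℙ × ℕ_{>0} → ℕ` as in the paper (conditions imposed only for `d > 1`). -/
def IsResidueFunctionTilde (rt : ℕ → ℕ) : Prop :=
  ∃ r : ℕ → ℕ → ℕ, IsResidueFunction r ∧
    ∀ d : ℕ, 1 < d → rt d < d ∧
      ∀ p j : ℕ, p.Prime → 1 ≤ j → p ^ j ∣ d → rt d ≡ r p j [MOD p ^ j]

/-- The theory `T_r̃ = T_MSO(Fin) ∪ {ψ_{>n} : n ∈ ℕ} ∪ {ρ_{d,r̃(d)} : d > 1}`. -/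
def Trt (rt : ℕ → ℕ) : Lmso.Theory :=
  TMSOFin ∪ Set.range psiGt ∪ {σ : Lmso.Sentence | ∃ d : ℕ, 1 < d ∧ σ = rho d (rt d)}

/-! ### Relativization and the sum of sentences -/

/-- Relativization of a formula to the elements `⊆ v`:
each quantifier `∀ Z (…)` becomes `∀ Z (Z ⊆ v → …)`. -/
def relv : ∀ {n : ℕ}, BF n → Fin n → BF n
  | _, BoundedFormula.falsum, _ => BoundedFormula.falsum
  | _, BoundedFormula.equal s t, _ => BoundedFormula.equal s t
  | _, BoundedFormula.rel r ts, _ => BoundedFormula.rel r ts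
  | _, BoundedFormula.imp f g, v => (relv f v).imp (relv g v)
  | n, BoundedFormula.all f, v =>
      BoundedFormula.all (sub' (Fin.last n) v.castSucc ⟹ relv f v.castSucc)

/-- `i` is downward closed with respect to the `≤ᴱ`-ordering of the atoms. -/
def dwcl' {n : ℕ} (i : Fin n) : BF n :=
  ∀' ∀' ((at' ((Fin.last n).castSucc) ⊓ at' (Fin.last (n + 1)) ⊓
      sub' ((Fin.last n).castSucc) (i.castSucc.castSucc) ⊓
      exle' (Fin.last (n + 1)) ((Fin.last n).castSucc)) ⟹
    sub' (Fin.last (n + 1)) (i.castSucc.castSucc))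

/-- The sentence `φ + ψ` : `∃ X (X downward closed ∧ φ^X ∧ ψ^(Xᶜ))`
(with the complement `Xᶜ` introduced by an existential quantifier). -/
def plusSent (φ ψ : Lmso.Sentence) : Lmso.Sentence :=
  ∃' ∃' (dwcl' (0 : Fin 2) ⊓ isComplOf (1 : Fin 2) (0 : Fin 2) ⊓
    relv (φ.liftAt 2 0) (0 : Fin 2) ⊓ relv (ψ.liftAt 2 0) (1 : Fin 2))

/-! ### `FSpec` and ultimate periodicity -/

/-- `FSpec φ` : the set of `n ∈ ℕ` such that `MSO(n) ⊨ φ`. -/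
def FSpec (φ : Lmso.Sentence) : Set ℕ := {n : ℕ | MSOn n ⊨ φ}

/-- A set of naturals is ultimately periodic. -/
def UltPeriodic (S : Set ℕ) : Prop :=
  ∃ N d : ℕ, 0 < d ∧ ∀ n : ℕ, N < n → (n ∈ S ↔ n + d ∈ S)

/-! ### The language `L_MO = {⊆, <}` -/

/-- The language `L_MO` with two binary relations: `⊆` (encoded `true`) and `<`
(encoded `false`). -/
def Lmo : Language where
  Functions := fun _ => Empty
  Relations := fun n => match n with | 2 => Bool | _ => Empty

/-- The monadic second order version `MSO(α)` of a linear order `α` as an `L_MO`-structure: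
`⊆` is inclusion and `<` is the ordering of `α` on singletons. -/
instance moStructure (α : Type*) [LinearOrder α] : Lmo.Structure (Set α) where
  funMap := fun f _ => f.elim
  RelMap := fun {n} r v => match n, r with
    | 2, true => v 0 ⊆ v 1
    | 2, false => ∃ a b : α, v 0 = {a} ∧ v 1 = {b} ∧ a < b

/-- A property of the length-`m` prefixes of infinite words over `A` is recognizable if it is
decided by a run of a deterministic automaton with finitely many states. -/
def Recognizable {A : Type} (P : ℕ → (ℕ → A) → Prop) : Prop :=
  ∃ (σ : Type) (_ : Finite σ) (f : ℕ → (ℕ → A) → σ) (step : σ → A → σ) (s : σ) (acc : σ → Prop),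
    (∀ W, f 0 W = s) ∧ (∀ m W, f (m + 1) W = step (f m W) (W m)) ∧ ∀ m W, P m W ↔ acc (f m W)

namespace Recognizable

variable {A : Type} {P Q : ℕ → (ℕ → A) → Prop}

theorem congr (hP : Recognizable P) (h : ∀ m W, Q m W ↔ P m W) : Recognizable Q := by
  obtain ⟨σ, hσ, f, step, s, acc, h0, h1, h2⟩ := hP
  exact ⟨σ, hσ, f, step, s, acc, h0, h1, fun m W => (h m W).trans (h2 m W)⟩

theorem const_false : Recognizable (A := A) fun _ _ => False :=
  ⟨Unit, inferInstance, fun _ _ => (), fun _ _ => (), (), fun _ => False,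
    fun _ => rfl, fun _ _ => rfl, fun _ _ => Iff.rfl⟩

theorem imp (hP : Recognizable P) (hQ : Recognizable Q) :
    Recognizable fun m W => P m W → Q m W := by
  obtain ⟨σ, hσ, f, step, s, acc, h0, h1, h2⟩ := hP
  obtain ⟨τ, hτ, g, step', t, acc', k0, k1, k2⟩ := hQ
  refine ⟨σ × τ, inferInstance, fun m W => (f m W, g m W),
    fun x a => (step x.1 a, step' x.2 a), (s, t), fun x => acc x.1 → acc' x.2, ?_, ?_, ?_⟩
  · intro W
    simp only [h0, k0]
  · intro m W
    simp only [h1, k1]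
  · intro m W
    simp only [h2, k2]

theorem not (hP : Recognizable P) : Recognizable fun m W => ¬ P m W :=
  hP.imp const_false

theorem and (hP : Recognizable P) (hQ : Recognizable Q) :
    Recognizable fun m W => P m W ∧ Q m W :=
  (hP.imp hQ.not).not.congr fun m W => by tauto

/-- Every letter of the prefix satisfies `p`. -/
theorem forall_lt (p : A → Prop) : Recognizable fun m W => ∀ j < m, p (W j) := by
  refine ⟨Prop, inferInstance, fun m W => ∀ j < m, p (W j), fun x a => x ∧ p a, True, id,
    ?_, ?_, fun _ _ => Iff.rfl⟩
  · simp
  · intro m W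
    simp only [Nat.forall_lt_succ_right]

theorem exists_lt_iff_succ (q : ℕ → Prop) (m : ℕ) :
    (∃ j < m + 1, q j) ↔ (∃ j < m, q j) ∨ q m := by
  simpa using Nat.exists_lt_succ_right (n := m) (p := q)

/-- Some letter of the prefix satisfies `p` and a later one satisfies `q`. -/
theorem exists_lt_lt (p q : A → Prop) :
    Recognizable fun m W => ∃ b < m, q (W b) ∧ ∃ a < b, p (W a) := by
  refine ⟨Prop × Prop, inferInstance,
    fun m W => (∃ a < m, p (W a), ∃ b < m, q (W b) ∧ ∃ a < b, p (W a)),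
    fun x a => (x.1 ∨ p a, x.2 ∨ (q a ∧ x.1)), (False, False), Prod.snd,
    ?_, ?_, fun _ _ => Iff.rfl⟩
  · simp
  · intro m W
    simp only [exists_lt_iff_succ]

/-- Projection: the subset construction. -/
theorem exists_track {n : ℕ} {P : ℕ → (ℕ → Fin (n + 1) → Prop) → Prop} (hP : Recognizable P) :
    Recognizable fun m W => ∃ X : ℕ → Prop,
      P m fun j => Fin.snoc (α := fun _ => Prop) (W j) (X j) := by
  obtain ⟨σ, hσ, f, step, s, acc, h0, h1, h2⟩ := hP
  have hf : ∀ m W W', (∀ j < m, W j = W' j) → f m W = f m W' := by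
    intro m
    induction m with
    | zero => intro W W' _; rw [h0, h0]
    | succ m ih =>
      intro W W' h
      rw [h1, h1, ih W W' fun j hj => h j (by omega), h m (by omega)]
  refine ⟨Set σ, inferInstance,
    fun m W => {x | ∃ X : ℕ → Prop, f m (fun j => Fin.snoc (α := fun _ => Prop) (W j) (X j)) = x},
    fun S a => {x | ∃ y ∈ S, ∃ b : Prop, step y (Fin.snoc (α := fun _ => Prop) a b) = x},
    {s}, fun S => ∃ x ∈ S, acc x, ?_, ?_, ?_⟩
  · intro W
    ext x
    simp [h0, eq_comm]
  · intro m W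
    ext x
    simp only [Set.mem_ofPred_eq, h1]
    constructor
    · rintro ⟨X, rfl⟩
      exact ⟨_, ⟨X, rfl⟩, X m, rfl⟩
    · rintro ⟨_, ⟨X, rfl⟩, b, rfl⟩
      refine ⟨Function.update X m b, ?_⟩
      rw [Function.update_self]
      congr 1
      refine hf m _ _ fun j hj => ?_
      rw [Function.update_of_ne hj.ne]
  · intro m W
    simp [h2]

theorem ultPeriodic {P : ℕ → (ℕ → A) → Prop} (hP : Recognizable P) (a : A) :
    UltPeriodic {n | P n fun _ => a} := by
  obtain ⟨σ, hσ, f, step, s, acc, h0, h1, h2⟩ := hP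
  obtain ⟨x, y, hne, hxy⟩ := Finite.exists_ne_map_eq_of_infinite fun n => f n fun _ => a
  wlog hlt : x < y generalizing x y
  · exact this y x hne.symm hxy.symm (by omega)
  have key : ∀ k, f (x + k) (fun _ => a) = f (y + k) fun _ => a := by
    intro k
    induction k with
    | zero => exact hxy
    | succ k ih => rw [← add_assoc, ← add_assoc, h1, h1, ih]
  refine ⟨x, y - x, by omega, fun n hn => ?_⟩
  have := key (n - x)
  rw [show x + (n - x) = n by omega, show y + (n - x) = n + (y - x) by omega] at this
  simp only [Set.mem_ofPred_eq, h2, this]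

end Recognizable

/-- The assignment in `MSO(m)` coded by the first `m` letters of a word. -/
def tracks {n : ℕ} (m : ℕ) (W : ℕ → Fin n → Prop) : Fin n → MSOn m := fun i => {j | W j i}

theorem snoc_tracks {n : ℕ} (m : ℕ) (W : ℕ → Fin n → Prop) (X : ℕ → Prop) :
    (Fin.snoc (tracks m W) {j : Fin m | X j} : Fin (n + 1) → MSOn m) =
      tracks m fun j => Fin.snoc (α := fun _ => Prop) (W j) (X j) := by
  funext i
  refine Fin.lastCases ?_ (fun i => ?_) i
  · simp [tracks]
  · simp [tracks]

theorem exists_realize_term {n : ℕ} (t : Lmso.Term (Empty ⊕ Fin n)) :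
    ∃ p : (Fin n → Prop) → Prop, ∀ (m : ℕ) (W : ℕ → Fin n → Prop) (v : Empty → MSOn m),
      t.realize (Sum.elim v (tracks m W)) = {j : Fin m | p (W j)} := by
  cases t with
  | var x =>
    obtain x | i := x
    · exact x.elim
    · exact ⟨fun a => a i, fun m W v => rfl⟩
  | @func l f ts =>
    match l, f with
    | 0, _ => exact ⟨fun _ => False, fun m W v => rfl⟩

theorem recognizable_realize {n : ℕ} (φ : BF n) :
    Recognizable fun m W => φ.Realize (M := MSOn m) default (tracks m W) := by
  induction φ with
  | falsum => exact Recognizable.const_false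
  | equal t u =>
    obtain ⟨p, hp⟩ := exists_realize_term t
    obtain ⟨q, hq⟩ := exists_realize_term u
    refine (Recognizable.forall_lt fun a => (p a ↔ q a)).congr fun m W => ?_
    simp only [BoundedFormula.Realize, hp, hq, Set.ext_iff, Set.mem_ofPred_eq, Fin.forall_iff]
  | @rel k l R ts =>
    choose p hp using fun i => exists_realize_term (ts i)
    match l, R with
    | 1, _ =>
      refine ((Recognizable.forall_lt fun a => ¬ p 0 a).not.and
        (Recognizable.exists_lt_lt (p 0) (p 0)).not).congr fun m W => ?_
      change (∃ a : Fin m,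
        (ts 0).realize (Sum.elim (default : Empty → MSOn m) (tracks m W)) = {a}) ↔ _
      rw [hp]
      constructor
      · rintro ⟨a, ha⟩
        simp only [Set.ext_iff, Set.mem_ofPred_eq, Set.mem_singleton_iff] at ha
        refine ⟨fun h => h a a.2 ((ha a).2 rfl), ?_⟩
        rintro ⟨b, hb, hpb, c, hc, hpc⟩
        have e₁ := (ha ⟨b, hb⟩).1 hpb
        have e₂ := (ha ⟨c, hc.trans hb⟩).1 hpc
        have := congrArg Fin.val (e₁.trans e₂.symm)
        simp only at this
        omega
      · rintro ⟨h₁, h₂⟩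
        push Not at h₁
        obtain ⟨a, ha, hpa⟩ := h₁
        refine ⟨⟨a, ha⟩, ?_⟩
        ext b
        simp only [Set.mem_ofPred_eq, Set.mem_singleton_iff]
        refine ⟨fun hb => ?_, fun hb => hb ▸ hpa⟩
        obtain h | h | h := lt_trichotomy (b : ℕ) a
        · exact (h₂ ⟨a, ha, hpa, b, h, hb⟩).elim
        · exact Fin.ext h
        · exact (h₂ ⟨b, b.2, hb, a, h, hpa⟩).elim
    | 2, true =>
      refine (Recognizable.forall_lt fun a => (p 0 a → p 1 a)).congr fun m W => ?_
      change (ts 0).realize (Sum.elim (default : Empty → MSOn m) (tracks m W)) ⊆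
        (ts 1).realize (Sum.elim (default : Empty → MSOn m) (tracks m W)) ↔ _
      rw [hp, hp]
      simp only [Set.subset_def, Set.mem_ofPred_eq, Fin.forall_iff]
    | 2, false =>
      refine (Recognizable.exists_lt_lt (p 0) (p 1)).congr fun m W => ?_
      change (∃ a ∈ (ts 0).realize (Sum.elim (default : Empty → MSOn m) (tracks m W)),
        ∃ b ∈ (ts 1).realize (Sum.elim (default : Empty → MSOn m) (tracks m W)), a < b) ↔ _
      rw [hp, hp]
      constructor
      · rintro ⟨a, ha, b, hb, hab⟩
        exact ⟨b, b.2, hb, a, hab, ha⟩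
      · rintro ⟨b, hb, hqb, a, ha, hpa⟩
        exact ⟨⟨a, ha.trans hb⟩, hpa, ⟨b, hb⟩, hqb, ha⟩
  | imp _ _ ihφ ihψ => exact ihφ.imp ihψ
  | all φ ih =>
    refine ih.not.exists_track.not.congr fun m W => ?_
    rw [BoundedFormula.realize_all, not_exists]
    simp only [not_not, ← snoc_tracks]
    refine ⟨fun h X => h _, fun h S => ?_⟩
    convert h fun j => ∃ hj : j < m, (⟨j, hj⟩ : Fin m) ∈ S
    ext j
    simp

theorem statement14 (φ : Lmso.Sentence) : UltPeriodic (FSpec φ) := by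
  convert (recognizable_realize φ).ultPeriodic default
  simp only [FSpec, Sentence.Realize, Formula.Realize]
  congr!

end MSO
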